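/- For the Sierpiński gasket matrices: for every real 2×2 positive semidefinite matrix H with Tr(H) = 1, every word α over {0,1,2}, and every m ≥ 0, |Tr(H · M^m(A(α) A(α)^T − ν(α) I))| ≤ 2 (4/5)^m ν(α). -/

import Mathlib

open MeasureTheory Matrix
open scoped ENNReal

/-- Rotation of the plane by the angle `2π/3`. -/
noncomputable def sgRot : Matrix (Fin 2) (Fin 2) ℝ :=
  !![Real.cos (2 * Real.pi / 3), -Real.sin (2 * Real.pi / 3);
     Real.sin (2 * Real.pi / 3),  Real.cos (2 * Real.pi / 3)]

/-- The diagonal matrix `D = diag(3/√15, 1/√15)`. -/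
noncomputable def sgD : Matrix (Fin 2) (Fin 2) ℝ :=
  !![3 / Real.sqrt 15, 0; 0, 1 / Real.sqrt 15]

/-- The Sierpiński gasket restriction maps `A_s = R^{-s} D R^{s}`, `s ∈ {0,1,2}`. -/
noncomputable def sgA (s : Fin 3) : Matrix (Fin 2) (Fin 2) ℝ :=
  (sgRot ^ (s : ℕ))⁻¹ * sgD * sgRot ^ (s : ℕ)

/-- The compound map `A(α) = A_{α₁} ⋯ A_{α_n}` of a word `α ∈ {0,1,2}^n`. -/
noncomputable def sgW {n : ℕ} (α : Fin n → Fin 3) : Matrix (Fin 2) (Fin 2) ℝ :=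
  (List.ofFn fun i => sgA (α i)).prod

/-- `ν(α) = (1/2)Tr(A(α) A(α)ᵀ)`. -/
noncomputable def sgNu {n : ℕ} (α : Fin n → Fin 3) : ℝ :=
  (1 / 2) * (sgW α * (sgW α)ᵀ).trace

/-- The operator `M(B) = ∑_{s=0}^{2} A_s B A_s` for the Sierpiński gasket system. -/
noncomputable def sgM (B : Matrix (Fin 2) (Fin 2) ℝ) : Matrix (Fin 2) (Fin 2) ℝ :=
  ∑ s : Fin 3, sgA s * B * sgA s

theorem sgRot_eq : sgRot = !![-1 / 2, -(√3 / 2); √3 / 2, -1 / 2] := by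
  have h : 2 * Real.pi / 3 = Real.pi - Real.pi / 3 := by ring
  rw [sgRot, h, Real.cos_pi_sub, Real.sin_pi_sub, Real.cos_pi_div_three, Real.sin_pi_div_three]
  norm_num

theorem sgRot_sq : sgRot ^ 2 = !![-1 / 2, √3 / 2; -(√3 / 2), -1 / 2] := by
  have h3 : √3 * √3 = 3 := Real.mul_self_sqrt (by norm_num)
  rw [sgRot_eq, pow_two]
  ext i j
  fin_cases i <;> fin_cases j <;> simp [Matrix.mul_apply] <;> linarith

theorem sgRot_mul_sq : sgRot * sgRot ^ 2 = 1 := by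
  have h3 : √3 * √3 = 3 := Real.mul_self_sqrt (by norm_num)
  rw [sgRot_sq, sgRot_eq]
  ext i j
  fin_cases i <;> fin_cases j <;> simp [Matrix.mul_apply] <;> linarith

theorem sgRot_inv : sgRot⁻¹ = sgRot ^ 2 := inv_eq_right_inv sgRot_mul_sq

theorem sgRot_sq_inv : (sgRot ^ 2)⁻¹ = sgRot := inv_eq_left_inv sgRot_mul_sq

theorem sgA_zero : sgA 0 = (√15)⁻¹ • !![3, 0; 0, 1] := by
  ext i j
  fin_cases i <;> fin_cases j <;> simp [sgA, sgD, div_eq_mul_inv, mul_comm]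

theorem sgA_one : sgA 1 = (√15)⁻¹ • !![3 / 2, √3 / 2; √3 / 2, 5 / 2] := by
  have h3 : √3 * √3 = 3 := Real.mul_self_sqrt (by norm_num)
  simp only [sgA, Fin.val_one, pow_one, sgRot_inv]
  rw [sgRot_sq, sgRot_eq, sgD]
  ext i j
  fin_cases i <;> fin_cases j <;> simp [Matrix.mul_apply] <;> grind

theorem sgA_two : sgA 2 = (√15)⁻¹ • !![3 / 2, -(√3 / 2); -(√3 / 2), 5 / 2] := by
  have h3 : √3 * √3 = 3 := Real.mul_self_sqrt (by norm_num)
  simp only [sgA, Fin.val_two, sgRot_sq_inv]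
  rw [sgRot_sq, sgRot_eq, sgD]
  ext i j
  fin_cases i <;> fin_cases j <;> simp [Matrix.mul_apply] <;> grind

/-- Trace-free symmetric matrices are eigenvectors of `sgM`. -/
theorem sgM_traceFree (b c : ℝ) : sgM !![b, c; c, -b] = (4 / 5 : ℝ) • !![b, c; c, -b] := by
  have h3 : √3 * √3 = 3 := Real.mul_self_sqrt (by norm_num)
  have h15 : (√15)⁻¹ * (√15)⁻¹ = 1 / 15 := by
    rw [← mul_inv, Real.mul_self_sqrt (by norm_num), one_div]
  rw [sgM, Fin.sum_univ_three, sgA_zero, sgA_one, sgA_two]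
  simp only [Matrix.smul_mul, Matrix.mul_smul, smul_smul, h15]
  ext i j
  fin_cases i <;> fin_cases j <;> simp <;> grind

theorem sgM_smul (t : ℝ) (B : Matrix (Fin 2) (Fin 2) ℝ) : sgM (t • B) = t • sgM B := by
  simp [sgM, Finset.smul_sum]

theorem sgM_iterate_traceFree (b c : ℝ) (m : ℕ) :
    sgM^[m] !![b, c; c, -b] = (4 / 5 : ℝ) ^ m • !![b, c; c, -b] := by
  induction m with
  | zero => simp
  | succ k ih => rw [Function.iterate_succ_apply', ih, sgM_smul, sgM_traceFree, smul_smul, pow_succ]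

/-- The trace-free part of a positive semidefinite `2 × 2` matrix has norm at most half its trace. -/
theorem Matrix.PosSemidef.traceFree_sq_le {P : Matrix (Fin 2) (Fin 2) ℝ} (hP : P.PosSemidef) :
    (P 0 0 - P 1 1) ^ 2 + (2 * P 0 1) ^ 2 ≤ P.trace ^ 2 := by
  have hdet := hP.det_nonneg
  have hsymm : P 1 0 = P 0 1 := by simpa using hP.isHermitian.apply 0 1
  rw [Matrix.det_fin_two, hsymm] at hdet
  rw [Matrix.trace_fin_two]
  nlinarith

/-- for every real positive semidefinite `H` with `Tr(H) = 1`, every word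
`α` over `{0,1,2}` and every `m ≥ 0`,
`|Tr(H · M^m(A(α)A(α)ᵀ − ν(α) I))| ≤ 2 (4/5)^m ν(α)`. -/
theorem sg_trace_estimate
    (H : Matrix (Fin 2) (Fin 2) ℝ) (hH : H.PosSemidef) (hHtr : H.trace = 1)
    {n : ℕ} (α : Fin n → Fin 3) (m : ℕ) :
    |(H * (sgM^[m] (sgW α * (sgW α)ᵀ - sgNu α • (1 : Matrix (Fin 2) (Fin 2) ℝ)))).trace| ≤
      2 * (4 / 5 : ℝ) ^ m * sgNu α := by
  set P := sgW α * (sgW α)ᵀ with hPdef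
  have hP : P.PosSemidef := by
    simpa [hPdef] using Matrix.posSemidef_self_mul_conjTranspose (sgW α)
  have hν : sgNu α = (P 0 0 + P 1 1) / 2 := by
    rw [sgNu, ← hPdef, Matrix.trace_fin_two]
    ring
  have hPsymm : P 1 0 = P 0 1 := by simpa using hP.isHermitian.apply 0 1
  have hHsymm : H 1 0 = H 0 1 := by simpa using hH.isHermitian.apply 0 1
  have hν0 : 0 ≤ P 0 0 + P 1 1 := by
    simpa [Matrix.trace_fin_two] using hP.trace_nonneg
  have hB : P - sgNu α • (1 : Matrix (Fin 2) (Fin 2) ℝ) =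
      !![(P 0 0 - P 1 1) / 2, P 0 1; P 0 1, -((P 0 0 - P 1 1) / 2)] := by
    rw [hν]
    ext i j
    fin_cases i <;> fin_cases j <;> simp [hPsymm] <;> ring
  have hPle := hP.traceFree_sq_le
  have hHle := hH.traceFree_sq_le
  rw [hHtr] at hHle
  rw [Matrix.trace_fin_two] at hPle
  have htrace : (H * !![(P 0 0 - P 1 1) / 2, P 0 1; P 0 1, -((P 0 0 - P 1 1) / 2)]).trace =
      ((H 0 0 - H 1 1) * (P 0 0 - P 1 1) + 2 * H 0 1 * (2 * P 0 1)) / 2 := by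
    simp [Matrix.trace_fin_two, Matrix.mul_apply, hHsymm]
    ring
  have hCS : |(H 0 0 - H 1 1) * (P 0 0 - P 1 1) + 2 * H 0 1 * (2 * P 0 1)| ≤
      P 0 0 + P 1 1 := by
    refine abs_le_of_sq_le_sq ?_ hν0
    have := mul_le_mul hHle hPle (by positivity) (by positivity)
    nlinarith [sq_nonneg ((H 0 0 - H 1 1) * (2 * P 0 1) - 2 * H 0 1 * (P 0 0 - P 1 1))]
  rw [hB, sgM_iterate_traceFree, Matrix.mul_smul, Matrix.trace_smul, smul_eq_mul, htrace,
    abs_mul, abs_of_nonneg (by positivity : (0 : ℝ) ≤ (4 / 5) ^ m), mul_comm 2 ((4 / 5 : ℝ) ^ m),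
    mul_assoc ((4 / 5 : ℝ) ^ m)]
  refine mul_le_mul_of_nonneg_left ?_ (by positivity)
  rw [hν, abs_div, abs_two]
  linarith
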